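/- arXiv:1104.3007 — 2 statements merged into one kernel-verified Lean document; each statement's English description precedes it below -/
import Mathlib

section
/- For every DFA M over an alphabet Σ there exists a hyper-optimal DFA for M; that is, there exists a DFA N over Σ such that N is hyper-minimal, L(M) △ L(N) is finite, and for every DFA N' over Σ that is hyper-minimal with L(M) △ L(N') finite, |L(M) △ L(N)| ≤ |L(M) △ L(N')|. -/
/-- The left language of state `q`: all strings taking `M` from its start state into `q`. -/
def leftLang {α σ : Type*} (M : DFA α σ) (q : σ) : Set (List α) :=
  {w | M.evalFrom M.start w = q}

/-- The right language of state `q`: all strings taking `M` from `q` into a final state. -/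
def rightLang {α σ : Type*} (M : DFA α σ) (q : σ) : Set (List α) :=
  {w | M.evalFrom q w ∈ M.accept}

/-- The language of `M`. -/
def lang {α σ : Type*} (M : DFA α σ) : Set (List α) :=
  rightLang M M.start

/-- States `q` and `p` of `M` are almost-equivalent if their right languages
are almost-equal. -/
def AlmostEq {α σ : Type*} (M : DFA α σ) (q p : σ) : Prop :=
  (symmDiff (rightLang M q) (rightLang M p)).Finite

/-- A kernel state: its left language is infinite. -/
def Kernel {α σ : Type*} (M : DFA α σ) (q : σ) : Prop :=
  (leftLang M q).Infinite

/-- A preamble state: its left language is finite. -/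
def Preamble {α σ : Type*} (M : DFA α σ) (q : σ) : Prop :=
  (leftLang M q).Finite

/-- `M` is minimal: every state is reachable and distinct states have distinct
right languages. -/
def MinimalDFA {α σ : Type*} (M : DFA α σ) : Prop :=
  (∀ q, (leftLang M q).Nonempty) ∧ ∀ q p, rightLang M q = rightLang M p → q = p

/-- `M` is hyper-minimal: it is minimal and has no pair of distinct almost-equivalent
states of which at least one is a preamble state. -/
def HyperMinimal {α σ : Type*} (M : DFA α σ) : Prop :=
  MinimalDFA M ∧ ¬ ∃ q p, q ≠ p ∧ AlmostEq M q p ∧ (Preamble M q ∨ Preamble M p)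

/-- `K_q`: the set of kernel states almost-equivalent to `q`. -/
def Kq {α σ : Type*} (M : DFA α σ) (q : σ) : Set σ :=
  {p | Kernel M p ∧ AlmostEq M p q}

/-- `P_∼`: the set of equivalence classes of the almost-equivalence consisting
exclusively of preamble states. -/
def Psim {α σ : Type*} (M : DFA α σ) : Set (Set σ) :=
  {B | (∃ q, B = {p | AlmostEq M q p}) ∧ ∀ p ∈ B, Preamble M p}

/-- `W_B`: the union of the left languages of the states of `B`. -/
def WB {α σ : Type*} (M : DFA α σ) (B : Set σ) : Set (List α) :=
  ⋃ q ∈ B, leftLang M q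

/-- `W_{B,σ}`: the strings `uσw` with `u ∈ W_B`. -/
def WBs {α σ : Type*} (M : DFA α σ) (B : Set σ) (a : α) : Set (List α) :=
  {w | ∃ u v, u ∈ WB M B ∧ w = u ++ a :: v}

theorem mem_sd_iff {β : Type*} (A B : Set β) (x : β) :
    x ∈ symmDiff A B ↔ ¬ (x ∈ A ↔ x ∈ B) := by
  rw [Set.mem_symmDiff]; tauto

theorem sd_trans {β : Type*} {A B C : Set β} (h1 : (symmDiff A B).Finite)
    (h2 : (symmDiff B C).Finite) : (symmDiff A C).Finite := by
  refine (h1.union h2).subset ?_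
  intro x hx
  rw [Set.mem_union]
  rw [mem_sd_iff] at *
  rw [mem_sd_iff]
  tauto

theorem no_cycle {α σ : Type} (M : DFA α σ) (q : σ) (hr : (leftLang M q).Nonempty)
    (hp : Preamble M q) (z : List α) (hz : M.evalFrom q z = q) : z = [] := by
  obtain ⟨u, hu, hmax⟩ := Set.exists_max_image (leftLang M q) List.length hp hr
  have hu' : M.evalFrom M.start u = q := hu
  have h := hmax (u ++ z) (by
    change M.evalFrom M.start (u ++ z) = q
    rw [DFA.evalFrom_of_append, hu', hz])
  rw [List.length_append] at h
  exact List.length_eq_zero_iff.mp (by omega)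

open Classical in
noncomputable def redir {σ : Type} (q p : σ) (hpq : p ≠ q) (s : σ) : {s : σ // s ≠ q} :=
  if h : s = q then ⟨p, hpq⟩ else ⟨s, h⟩

noncomputable def redirDFA {α σ : Type} (M : DFA α σ) (q p : σ) (hpq : p ≠ q) :
    DFA α {s : σ // s ≠ q} where
  step s a := redir q p hpq (M.step s.1 a)
  start := redir q p hpq M.start
  accept := {s | s.1 ∈ M.accept}

theorem redir_avoid {α σ : Type} (M : DFA α σ) (q p : σ) (hpq : p ≠ q) (w : List α) :
    ∀ s : {s : σ // s ≠ q}, (∀ z, M.evalFrom s.1 z ≠ q) →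
      ((redirDFA M q p hpq).evalFrom s w).1 = M.evalFrom s.1 w := by
  induction w with
  | nil => intro s _; rfl
  | cons a w ih =>
    intro s hs
    have h1 : M.step s.1 a ≠ q := hs [a]
    have h2 : (redirDFA M q p hpq).step s a = ⟨M.step s.1 a, h1⟩ := by
      simp [redirDFA, redir, h1]
    rw [DFA.evalFrom_cons, DFA.evalFrom_cons, h2]
    exact ih ⟨M.step s.1 a, h1⟩ (fun z => hs (a :: z))

theorem redir_diff {α σ : Type} (M : DFA α σ) (q p : σ) (hpq : p ≠ q)
    (hav : ∀ z, M.evalFrom p z ≠ q) (w : List α) :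
    ∀ s : σ, ¬ (w ∈ rightLang M s ↔
        w ∈ rightLang (redirDFA M q p hpq) (redir q p hpq s)) →
      ∃ u v, w = u ++ v ∧ M.evalFrom s u = q ∧ ¬ (v ∈ rightLang M q ↔ v ∈ rightLang M p) := by
  have key : ∀ (w : List α) (s : σ), s = q → ¬ (w ∈ rightLang M s ↔
        w ∈ rightLang (redirDFA M q p hpq) (redir q p hpq s)) →
      ¬ (w ∈ rightLang M q ↔ w ∈ rightLang M p) := by
    intro w s hs h
    subst hs
    have h2 : redir s p hpq s = ⟨p, hpq⟩ := by simp [redir]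
    have h3 := redir_avoid M s p hpq w ⟨p, hpq⟩ hav
    intro h4
    apply h
    rw [h4, h2]
    change M.evalFrom p w ∈ M.accept ↔ ((redirDFA M s p hpq).evalFrom ⟨p, hpq⟩ w).1 ∈ M.accept
    rw [h3]
  induction w with
  | nil =>
    intro s h
    by_cases hs : s = q
    · exact ⟨[], [], rfl, hs, key _ s hs h⟩
    · exfalso; apply h
      simp [rightLang, redir, hs, redirDFA]
  | cons a w ih =>
    intro s h
    by_cases hs : s = q
    · exact ⟨[], a :: w, rfl, hs, key _ s hs h⟩
    · have h2 : redir q p hpq s = ⟨s, hs⟩ := by simp [redir, hs]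
      rw [h2] at h
      obtain ⟨u, v, e, h3, h4⟩ := ih (M.step s a) h
      exact ⟨a :: u, v, by rw [e]; rfl, h3, h4⟩

theorem redir_finite {α σ : Type} (M : DFA α σ) (q p : σ) (hpq : p ≠ q)
    (hav : ∀ z, M.evalFrom p z ≠ q) (hq : Preamble M q) (he : AlmostEq M q p) :
    (symmDiff (lang M) (lang (redirDFA M q p hpq))).Finite := by
  refine (Set.Finite.image2 (fun u v => u ++ v) hq he).subset ?_
  intro w hw
  rw [mem_sd_iff] at hw
  obtain ⟨u, v, e, h1, h2⟩ := redir_diff M q p hpq hav w M.start hw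
  exact ⟨u, h1, v, (mem_sd_iff _ _ _).2 h2, e.symm⟩

theorem toDFA_evalFrom {α : Type} (L : Language α) (w : List α) :
    ∀ s, (L.toDFA.evalFrom s w).1 = s.1.leftQuotient w := by
  induction w with
  | nil => intro s; rfl
  | cons a w ih =>
    intro s
    rw [DFA.evalFrom_cons, ih, Language.step_toDFA, ← Language.leftQuotient_append]; rfl

theorem toDFA_rightLang {α : Type} (L : Language α) (s : Set.range L.leftQuotient) :
    rightLang L.toDFA s = s.1 := by
  ext w
  change [] ∈ (L.toDFA.evalFrom s w).1 ↔ w ∈ s.1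
  rw [toDFA_evalFrom, Language.mem_leftQuotient, List.append_nil]

theorem toDFA_minimal {α : Type} (L : Language α) : MinimalDFA L.toDFA := by
  refine ⟨?_, ?_⟩
  · rintro ⟨_, w, rfl⟩
    exact ⟨w, Subtype.ext (toDFA_evalFrom L w _)⟩
  · intro q p h
    rw [toDFA_rightLang, toDFA_rightLang] at h
    exact Subtype.ext h

theorem exists_hm {α : Type} (n : ℕ) : ∀ (σ : Type) (_ : Fintype σ) (M : DFA α σ),
    Fintype.card σ = n → ∃ (σN : Type) (_ : Fintype σN) (N : DFA α σN),
      HyperMinimal N ∧ (symmDiff (lang M) (lang N)).Finite := by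
  classical
  induction n using Nat.strong_induction_on with
  | _ n ih =>
  intro σ _ M hn
  let L : Language α := M.accepts
  have hsub : Set.range L.leftQuotient ⊆ Set.range M.acceptsFrom := by
    rintro _ ⟨w, rfl⟩
    exact ⟨M.eval w, (Language.leftQuotient_accepts_apply M w).symm⟩
  have hfin : (Set.range L.leftQuotient).Finite := (Set.finite_range _).subset hsub
  letI : Fintype (Set.range L.leftQuotient) := hfin.fintype
  have hcard : Fintype.card (Set.range L.leftQuotient) ≤ n := by
    rw [← hn, ← Nat.card_eq_fintype_card, ← Nat.card_eq_fintype_card]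
    exact (Nat.card_mono (Set.finite_range _) hsub).trans
      (Finite.card_range_le _)
  have hlang : lang L.toDFA = lang M := toDFA_rightLang L _
  have hmin := toDFA_minimal L
  by_cases hh : HyperMinimal L.toDFA
  · exact ⟨_, inferInstance, L.toDFA, hh, by rw [hlang]; simp⟩
  have hex : ∃ q p, q ≠ p ∧ AlmostEq L.toDFA q p ∧ Preamble L.toDFA q := by
    by_contra hcon
    apply hh
    refine ⟨hmin, ?_⟩
    rintro ⟨q, p, h1, h2, h3 | h3⟩
    · exact hcon ⟨q, p, h1, h2, h3⟩
    · exact hcon ⟨p, q, h1.symm, by unfold AlmostEq at *; rwa [symmDiff_comm], h3⟩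
  have hex2 : ∃ q p, p ≠ q ∧ AlmostEq L.toDFA q p ∧ Preamble L.toDFA q ∧
      ∀ z, L.toDFA.evalFrom p z ≠ q := by
    obtain ⟨q, p, h1, h2, h3⟩ := hex
    by_cases hz : ∀ z, L.toDFA.evalFrom p z ≠ q
    · exact ⟨q, p, h1.symm, h2, h3, hz⟩
    · push Not at hz
      obtain ⟨z, hz⟩ := hz
      refine ⟨p, q, h1, by unfold AlmostEq at *; rwa [symmDiff_comm], ?_, ?_⟩
      · refine Set.Finite.of_finite_image (f := fun u => u ++ z) (h3.subset ?_) ?_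
        · rintro _ ⟨u, hu, rfl⟩
          have hu' : L.toDFA.evalFrom L.toDFA.start u = p := hu
          change L.toDFA.evalFrom L.toDFA.start (u ++ z) = q
          rw [DFA.evalFrom_of_append, hu', hz]
        · intro a _ b _ hab
          exact List.append_cancel_right hab
      · intro y hy
        have := no_cycle L.toDFA q (hmin.1 q) h3 (y ++ z) (by
          rw [DFA.evalFrom_of_append, hy, hz])
        have hy0 : y = [] := (List.append_eq_nil_iff.mp this).1
        subst hy0
        exact h1 hy
  obtain ⟨q, p, h1, h2, h3, h4⟩ := hex2
  have hf := redir_finite L.toDFA q p h1 h4 h3 h2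
  obtain ⟨σN, i, N, hN, hd⟩ := ih (Fintype.card {s : Set.range L.leftQuotient // s ≠ q})
    (lt_of_lt_of_le (Fintype.card_subtype_lt (x := q) (by simp)) hcard) _ _
    (redirDFA L.toDFA q p h1) rfl
  rw [hlang] at hf
  exact ⟨σN, i, N, hN, sd_trans hf hd⟩

theorem stmt18 {α σ : Type} [Fintype α] [Fintype σ] (M : DFA α σ) :
    ∃ (σN : Type) (_ : Fintype σN) (N : DFA α σN),
      HyperMinimal N ∧ (symmDiff (lang M) (lang N)).Finite ∧
        ∀ (σ' : Type) (_ : Fintype σ') (N' : DFA α σ'),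
          HyperMinimal N' → (symmDiff (lang M) (lang N')).Finite →
            (symmDiff (lang M) (lang N)).ncard ≤ (symmDiff (lang M) (lang N')).ncard := by
  classical
  have hex : ∃ n : ℕ, ∃ (σN : Type) (_ : Fintype σN) (N : DFA α σN),
      HyperMinimal N ∧ (symmDiff (lang M) (lang N)).Finite ∧
        (symmDiff (lang M) (lang N)).ncard = n := by
    obtain ⟨σN, i, N, h1, h2⟩ := exists_hm _ σ inferInstance M rfl
    exact ⟨_, σN, i, N, h1, h2, rfl⟩
  obtain ⟨σN, i, N, h1, h2, h3⟩ := Nat.find_spec hex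
  refine ⟨σN, i, N, h1, h2, ?_⟩
  intro σ' i' N' h1' h2'
  rw [h3]
  exact Nat.find_min' hex ⟨σ', i', N', h1', h2', rfl⟩
end

section
/- Let M be a hyper-minimal DFA over an alphabet Σ and let N be any DFA over Σ with L(M) △ L(N) finite. Then N has at least as many states as M. -/
theorem aux_quot {α σ σ' : Type*} (M : DFA α σ) (N : DFA α σ') (w u : List α) :
    w ++ u ∈ symmDiff (lang M) (lang N) ↔
      u ∈ symmDiff (rightLang M (M.evalFrom M.start w)) (rightLang N (N.evalFrom N.start w)) := by
  simp only [Set.mem_symmDiff, lang, rightLang, Set.mem_setOf_eq, DFA.evalFrom_of_append]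

theorem aux_fin {α σ σ' : Type*} (M : DFA α σ) (N : DFA α σ')
    (h : (symmDiff (lang M) (lang N)).Finite) (w : List α) :
    (symmDiff (rightLang M (M.evalFrom M.start w))
      (rightLang N (N.evalFrom N.start w))).Finite := by
  refine (h.preimage (f := fun u => w ++ u) ?_).subset ?_
  · intro a _ b _ hab
    exact List.append_cancel_left hab
  · intro u hu
    exact (aux_quot M N w u).2 hu

theorem aux_choice {α σ σ' : Type*} (M : DFA α σ) (hM : HyperMinimal M) (N : DFA α σ')
    (h : (symmDiff (lang M) (lang N)).Finite) (q : σ) :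
    ∃ w, M.evalFrom M.start w = q ∧
      (Kernel M q → rightLang M q = rightLang N (N.evalFrom N.start w)) := by
  by_cases hk : Kernel M q
  · have hP : (⋃ v ∈ symmDiff (lang M) (lang N), {w | w ∈ v.inits}).Finite :=
      h.biUnion fun v _ => List.finite_toSet v.inits
    obtain ⟨w, hw, hn⟩ := Set.Infinite.exists_notMem_finite hk hP
    have hw' : M.evalFrom M.start w = q := hw
    refine ⟨w, hw', fun _ => ?_⟩
    have he : symmDiff (rightLang M q) (rightLang N (N.evalFrom N.start w)) = ∅ := by
      apply Set.eq_empty_of_forall_notMem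
      intro u hu
      rw [← hw'] at hu
      apply hn
      simp only [Set.mem_iUnion]
      refine ⟨w ++ u, (aux_quot M N w u).2 hu, ?_⟩
      simp
    exact symmDiff_eq_bot.1 he
  · obtain ⟨w, hw⟩ := hM.1.1 q
    exact ⟨w, hw, fun hk' => absurd hk' hk⟩

theorem stmt19 {α σ σ' : Type*} [Fintype α] [Fintype σ] [Fintype σ']
    (M : DFA α σ) (hM : HyperMinimal M) (N : DFA α σ')
    (h : (symmDiff (lang M) (lang N)).Finite) :
    Fintype.card σ ≤ Fintype.card σ' := by
  choose f hf hk using aux_choice M hM N h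
  apply Fintype.card_le_of_injective (fun q => N.evalFrom N.start (f q))
  intro q p hqp
  have hqp' : N.evalFrom N.start (f q) = N.evalFrom N.start (f p) := hqp
  by_contra hne
  have hpre : ¬ (Preamble M q ∨ Preamble M p) := by
    intro hp
    refine hM.2 ⟨q, p, hne, ?_, hp⟩
    have h1 := aux_fin M N h (f q)
    have h2 := aux_fin M N h (f p)
    rw [hf, hqp'] at h1
    rw [hf, symmDiff_comm] at h2
    exact (h1.union h2).subset (symmDiff_triangle _ _ _)
  push Not at hpre
  apply hne
  apply hM.1.2
  rw [hk q hpre.1, hk p hpre.2, hqp']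
end
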